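/- arXiv:2405.13536 — 2 statements merged into one kernel-verified Lean document; each statement's English description precedes it below -/
import Mathlib

section
/- (Converse corollary.) Let C ≥ 2. If a single-layer, single-head transformer F (encoder or decoder variant) satisfies F(t) = b + Σ_{i=1}^{n} w_i(t_i) for every sequence t = [t_1,…,t_n] with 1 ≤ n ≤ C, for some additive model with weight maps w_i : V → ℝ and offset b ∈ ℝ, then w_i(τ) = 0 for every token τ ∈ V and every position i ∈ {2,…,C}; that is, any additive model represented by such a transformer is fully determined by the first token (and hence the transformer's output on sequences of length ≤ C depends only on the first token). -/
open scoped BigOperators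

noncomputable section

/-- Dot product on `Fin m → ℝ`. -/
def dotp {m : ℕ} (x y : Fin m → ℝ) : ℝ := ∑ i, x i * y i

/-- A single-layer, single-head transformer without positional embeddings. -/
structure Transformer (V : Type*) (d dh : ℕ) where
  e : V → Fin d → ℝ
  WQ : Matrix (Fin d) (Fin dh) ℝ
  WK : Matrix (Fin d) (Fin dh) ℝ
  WV : Matrix (Fin d) (Fin dh) ℝ
  bQ : Fin dh → ℝ
  bK : Fin dh → ℝ
  bV : Fin dh → ℝ
  P : (Fin dh → ℝ) → (Fin d → ℝ)
  ffn : (Fin d → ℝ) → (Fin d → ℝ)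
  cls : (Fin d → ℝ) → (Fin 2 → ℝ)

namespace Transformer

variable {V : Type*} {d dh : ℕ}

/-- Query vector `W_Q^⊤ h + b_Q`. -/
def qvec (T : Transformer V d dh) (h : Fin d → ℝ) : Fin dh → ℝ :=
  fun j => (∑ i, T.WQ i j * h i) + T.bQ j

/-- Key vector `W_K^⊤ h + b_K`. -/
def kvec (T : Transformer V d dh) (h : Fin d → ℝ) : Fin dh → ℝ :=
  fun j => (∑ i, T.WK i j * h i) + T.bK j

/-- Value vector `W_V^⊤ h + b_V`. -/
def vvec (T : Transformer V d dh) (h : Fin d → ℝ) : Fin dh → ℝ :=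
  fun j => (∑ i, T.WV i j * h i) + T.bV j

/-- Attention index set `J_i`: full for the encoder (`dec = false`),
causally masked (`j ≤ i`) for the decoder (`dec = true`). -/
def J (dec : Bool) {n : ℕ} (i : Fin n) : Finset (Fin n) :=
  if dec then Finset.univ.filter (fun j => j ≤ i) else Finset.univ

/-- Pre-softmax exponentiated attention score `exp(q_i ⬝ k_j / √dh)`. -/
def score (T : Transformer V d dh) {n : ℕ} (t : Fin n → V) (i j : Fin n) : ℝ :=
  Real.exp (dotp (T.qvec (T.e (t i))) (T.kvec (T.e (t j))) / Real.sqrt dh)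

/-- Attention weight `α_{ij}`. -/
def attn (T : Transformer V d dh) (dec : Bool) {n : ℕ} (t : Fin n → V) (i j : Fin n) : ℝ :=
  if j ∈ J dec i then T.score t i j / ∑ j' ∈ J dec i, T.score t i j' else 0

/-- Attention output `s_i = Σ_j α_{ij} v_j`. -/
def sout (T : Transformer V d dh) (dec : Bool) {n : ℕ} (t : Fin n → V) (i : Fin n) :
    Fin dh → ℝ :=
  ∑ j, T.attn dec t i j • T.vvec (T.e (t j))

/-- Classification index: first token for the encoder, last token for the decoder. -/
def clsIdx (dec : Bool) {n : ℕ} (hn : 0 < n) : Fin n :=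
  if dec then ⟨n - 1, Nat.sub_lt hn Nat.one_pos⟩ else ⟨0, hn⟩

/-- Log-odds output `F(t) = Δ(cls(ffn(h_r + P(s_r))))`. -/
def F (T : Transformer V d dh) (dec : Bool) {n : ℕ} (hn : 0 < n) (t : Fin n → V) : ℝ :=
  T.cls (T.ffn (T.e (t (clsIdx dec hn)) + T.P (T.sout dec t (clsIdx dec hn)))) 1
    - T.cls (T.ffn (T.e (t (clsIdx dec hn)) + T.P (T.sout dec t (clsIdx dec hn)))) 0

end Transformer

theorem Transformer.F_const {V : Type*} {d dh : ℕ} (T : Transformer V d dh) (dec : Bool)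
    {n : ℕ} (hn : 0 < n) (τ : V) :
    T.F dec hn (fun _ => τ) =
      T.cls (T.ffn (T.e τ + T.P (T.vvec (T.e τ)))) 1
        - T.cls (T.ffn (T.e τ + T.P (T.vvec (T.e τ)))) 0 := by
  have hs : ∀ i : Fin n, T.sout dec (fun _ => τ) i = T.vvec (T.e τ) := by
    intro i
    have hi : i ∈ Transformer.J dec i := by
      cases dec <;> simp [Transformer.J]
    have hpos : 0 < ∑ j' ∈ Transformer.J dec i, T.score (fun _ => τ) i j' :=
      Finset.sum_pos (fun j _ => Real.exp_pos _) ⟨i, hi⟩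
    unfold Transformer.sout
    rw [← Finset.sum_smul]
    have h1 : ∑ j, T.attn dec (fun _ => τ) i j = 1 := by
      unfold Transformer.attn
      rw [Finset.sum_ite_mem, Finset.univ_inter, ← Finset.sum_div]
      exact div_self hpos.ne'
    rw [h1, one_smul]
  unfold Transformer.F
  rw [hs]

/-- converse corollary: if a single-layer, single-head transformer
(encoder or decoder variant) represents an additive model on all sequences of
length at most `C` (with `C ≥ 2`), then the weights `w_i` vanish at all positions
`i ∈ {2,…,C}` (i.e. indices `i : Fin C` with `0 < i`) and all tokens; hence the
transformer's output on sequences of length `≤ C` depends only on the first token. -/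
theorem transformer_additive_is_first_token_determined {V : Type*} [Fintype V]
    {d dh : ℕ} (hd : 1 ≤ d) (hdh : 1 ≤ dh)
    (C : ℕ) (hC : 2 ≤ C) (T : Transformer V d dh) (dec : Bool)
    (w : Fin C → V → ℝ) (b : ℝ)
    (hrep : ∀ (n : ℕ) (hn : 1 ≤ n) (hnC : n ≤ C) (t : Fin n → V),
        T.F dec hn t = b + ∑ i : Fin n, w (Fin.castLE hnC i) (t i)) :
    (∀ (i : Fin C), 0 < (i : ℕ) → ∀ τ : V, w i τ = 0) ∧
    (∀ (n : ℕ) (hn : 1 ≤ n) (_ : n ≤ C) (t t' : Fin n → V),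
        t ⟨0, hn⟩ = t' ⟨0, hn⟩ → T.F dec hn t = T.F dec hn t') := by
  have hw : ∀ (i : Fin C), 0 < (i : ℕ) → ∀ τ : V, w i τ = 0 := by
    rintro ⟨m, hm⟩ hi τ
    simp only at hi
    have h1 := hrep m hi hm.le (fun _ => τ)
    have h2 := hrep (m + 1) (Nat.succ_pos m) hm (fun _ => τ)
    rw [Transformer.F_const] at h1 h2
    rw [Fin.sum_univ_castSucc, h1] at h2
    have h3 : ∑ i : Fin m, w (Fin.castLE hm i.castSucc) τ
        = ∑ i : Fin m, w (Fin.castLE hm.le i) τ := rfl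
    have h4 : w (Fin.castLE hm (Fin.last m)) τ = w ⟨m, hm⟩ τ := rfl
    linarith
  refine ⟨hw, ?_⟩
  intro n hn hnC t t' h0
  rw [hrep n hn hnC t, hrep n hn hnC t']
  congr 1
  refine Finset.sum_congr rfl fun i _ => ?_
  by_cases hi : 0 < (i : ℕ)
  · rw [hw _ hi, hw _ hi]
  · have : i = ⟨0, hn⟩ := Fin.ext (by simpa using hi)
    rw [this, h0]
end
end

section
/- (Corollary: transformers cannot represent linear models.) Let C ≥ 2 be a context length, let w : V → ℝ be a position-independent weight map with w(τ) ≠ 0 for at least one token τ ∈ V, and let b ∈ ℝ. Then there exists no choice of parameters of the single-layer, single-head transformer (encoder or decoder variant) such that F(t) = b + Σ_{i=1}^{n} w(t_i) for every sequence t = [t_1,…,t_n] with 1 ≤ n ≤ C. -/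
open scoped BigOperators

noncomputable section

theorem Transformer.sout_const {V : Type*} {d dh : ℕ} (T : Transformer V d dh) (dec : Bool)
    {n : ℕ} (τ : V) (i : Fin n) :
    T.sout dec (fun _ => τ) i = T.vvec (T.e τ) := by
  have hi : i ∈ Transformer.J dec i := by
    unfold Transformer.J
    split <;> simp
  have hpos : 0 < ∑ j' ∈ Transformer.J dec i, T.score (fun _ => τ) i j' :=
    Finset.sum_pos (fun j _ => Real.exp_pos _) ⟨i, hi⟩
  unfold Transformer.sout
  rw [← Finset.sum_smul]
  have h1 : ∑ j, T.attn dec (fun _ => τ) i j = 1 := by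
    unfold Transformer.attn
    rw [Finset.sum_ite_mem, Finset.univ_inter, ← Finset.sum_div]
    exact div_self hpos.ne'
  rw [h1, one_smul]

/-- corollary: single-layer, single-head transformers (encoder or decoder
variant) cannot represent any non-trivial linear model, i.e. any position-independent
weight map `w : V → ℝ` with `w τ ≠ 0` for some token `τ`, on all sequences of length
at most `C` for a context length `C ≥ 2`. -/
theorem transformer_cannot_represent_linear {V : Type*} [Fintype V]
    (C : ℕ) (hC : 2 ≤ C) (w : V → ℝ) (b : ℝ) (hw : ∃ τ : V, w τ ≠ 0) :
    ¬ ∃ (d dh : ℕ) (_ : 1 ≤ d) (_ : 1 ≤ dh) (T : Transformer V d dh) (dec : Bool),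
        ∀ (n : ℕ) (hn : 1 ≤ n) (_ : n ≤ C) (t : Fin n → V),
          T.F dec hn t = b + ∑ i : Fin n, w (t i) := by
  rintro ⟨d, dh, _, _, T, dec, h⟩
  obtain ⟨τ, hτ⟩ := hw
  have h1 := h 1 le_rfl (by omega) (fun _ => τ)
  have h2 := h 2 (by omega) hC (fun _ => τ)
  simp only [Transformer.F, Transformer.sout_const] at h1 h2
  rw [h1] at h2
  simp at h2
  apply hτ
  linarith
end
end
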